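/- arXiv:2510.05243 — 9 statements merged into one kernel-verified Lean document; each statement's English description precedes it below -/
import Mathlib

section
/- Let 0 ≤ γ < κ and let Φ : [0,∞) → ℝ be differentiable with Φ'(t) = γ − κ·sin(Φ(t)) for all t ≥ 0. Set Φ* = arcsin(γ/κ). If Φ(0) ∈ (−π − Φ*, π − Φ*), then Φ(t) → Φ* as t → ∞. -/
open Real Filter

/-- The function `2 arctan (tan a + k e^{-κ cos a t}) - a` solves `Φ' = κ sin a - κ sin Φ`. -/
lemma hasDerivAt_two_mul_arctan_sub {a : ℝ} (ha : cos a ≠ 0) (κ k t : ℝ) :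
    HasDerivAt (fun t => 2 * arctan (tan a + k * exp (-(κ * cos a) * t)) - a)
      (κ * sin a - κ * sin (2 * arctan (tan a + k * exp (-(κ * cos a) * t)) - a)) t := by
  have h₁ : HasDerivAt (fun t => tan a + k * exp (-(κ * cos a) * t))
      (k * (exp (-(κ * cos a) * t) * (-(κ * cos a) * 1))) t :=
    ((((hasDerivAt_id t).const_mul (-(κ * cos a))).exp).const_mul k).const_add (tan a)
  refine ((h₁.arctan.const_mul 2).sub_const a).congr_deriv ?_
  generalize exp (-(κ * cos a) * t) = e
  set x := tan a + k * e with hx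
  have hk : k * e * cos a = x * cos a - sin a := by
    rw [hx, add_mul, tan_mul_cos ha]; ring
  have hpos : 1 + x ^ 2 ≠ 0 := by positivity
  have hcos : cos (arctan x) ^ 2 = 1 / (1 + x ^ 2) := cos_sq_arctan x
  have hsin : sin (arctan x) = x * cos (arctan x) := by
    rw [← tan_mul_cos (cos_arctan_pos x).ne', tan_arctan]
  have hs : sin (2 * arctan x - a) = (2 * x * cos a - (1 - x ^ 2) * sin a) / (1 + x ^ 2) := by
    rw [sin_sub, sin_two_mul, cos_two_mul, hsin]
    have : 2 * (x * cos (arctan x)) * cos (arctan x) = 2 * x * cos (arctan x) ^ 2 := by ring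
    rw [this, hcos]
    field_simp
    ring
  rw [hs]
  field_simp
  linear_combination (-2 * κ) * hk

/-- Convergence of the phase difference to the phase-locked state `Φ* = arcsin (γ/κ)`
for the scalar ODE `Φ' = γ - κ sin Φ` when `0 ≤ γ < κ`. -/
theorem phase_difference_tendsto_locked (γ κ : ℝ) (hγ : 0 ≤ γ) (hγκ : γ < κ)
    (Φ : ℝ → ℝ)
    (hΦ : ∀ t : ℝ, 0 ≤ t → HasDerivAt Φ (γ - κ * Real.sin (Φ t)) t)
    (h0 : Φ 0 ∈ Set.Ioo (-π - Real.arcsin (γ / κ)) (π - Real.arcsin (γ / κ))) :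
    Tendsto Φ atTop (nhds (Real.arcsin (γ / κ))) := by
  have hκ : 0 < κ := hγ.trans_lt hγκ
  have hlt : γ / κ < 1 := (div_lt_one hκ).2 hγκ
  have hnonneg : 0 ≤ γ / κ := div_nonneg hγ hκ.le
  have hsin : κ * sin (arcsin (γ / κ)) = γ := by
    rw [sin_arcsin (by linarith) hlt.le, mul_div_cancel₀ _ hκ.ne']
  have ha₀ : -(π / 2) < arcsin (γ / κ) := neg_pi_div_two_lt_arcsin.2 (by linarith)
  have ha₁ : arcsin (γ / κ) < π / 2 := arcsin_lt_pi_div_two.2 hlt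
  generalize arcsin (γ / κ) = a at *
  have hcos : 0 < cos a := cos_pos_of_mem_Ioo ⟨ha₀, ha₁⟩
  set k := tan ((Φ 0 + a) / 2) - tan a with hk
  set Ψ : ℝ → ℝ := fun t => 2 * arctan (tan a + k * exp (-(κ * cos a) * t)) - a with hΨ
  have hΨ' (t : ℝ) : HasDerivAt Ψ (γ - κ * sin (Ψ t)) t := by
    simpa only [hsin] using hasDerivAt_two_mul_arctan_sub hcos.ne' κ k t
  have hinit : Φ 0 = Ψ 0 := by
    simp only [hΨ, hk, mul_zero, exp_zero, mul_one, add_sub_cancel]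
    rw [arctan_tan (by linarith [h0.1]) (by linarith [h0.2])]
    ring
  have hlip : LipschitzWith κ.toNNReal (fun x => γ - κ * sin x) := by
    refine lipschitzWith_of_nnnorm_deriv_le (by fun_prop) fun x => ?_
    rw [← NNReal.coe_le_coe, coe_nnnorm, coe_toNNReal _ hκ.le]
    have hd : HasDerivAt (fun x => γ - κ * sin x) (-(κ * cos x)) x :=
      ((hasDerivAt_sin x).const_mul κ).const_sub γ
    rw [hd.deriv, norm_neg, norm_mul, norm_of_nonneg hκ.le]
    exact mul_le_of_le_one_right hκ.le (abs_cos_le_one x)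
  have heq (t : ℝ) (ht : 0 ≤ t) : Φ t = Ψ t :=
    ODE_solution_unique (v := fun _ x => γ - κ * sin x) (fun _ => hlip)
      (fun s hs => (hΦ s hs.1).continuousAt.continuousWithinAt)
      (fun s hs => (hΦ s hs.1).hasDerivWithinAt)
      (fun s _ => (hΨ' s).continuousAt.continuousWithinAt)
      (fun s _ => (hΨ' s).hasDerivWithinAt) hinit ⟨ht, le_rfl⟩
  have hexp : Tendsto (fun t => exp (-(κ * cos a) * t)) atTop (nhds 0) :=
    tendsto_exp_atBot.comp
      (tendsto_id.const_mul_atTop_of_neg (neg_neg_of_pos (mul_pos hκ hcos)))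
  have hlim : Tendsto Ψ atTop (nhds (2 * arctan (tan a + k * 0) - a)) :=
    (((continuous_arctan.tendsto _).comp
      ((hexp.const_mul k).const_add (tan a))).const_mul 2).sub_const a
  rw [mul_zero, add_zero, arctan_tan ha₀ ha₁, two_mul, add_sub_cancel_right] at hlim
  refine hlim.congr' ?_
  filter_upwards [eventually_ge_atTop 0] with t ht using (heq t ht).symm
end

section
/- Let α₁ > α₂ be real, κ > 0, γ > 0, and set a = α₁ − α₂. Define A = √( (√(4a²γ² + (a² − γ² + κ²)²) + a² − γ² + κ²)/2 ) and f = α₁ + α₂ − κ + A. Let w ∈ ℂ satisfy w² = (a + iγ)² + κ² and Re(w) > 0, and put Y_∞⁺ = (a + iγ + w)/κ. Then Re(w) = A, Re(Y_∞⁺) = (a + A)/κ, Re(1/Y_∞⁺) = (A − a)/κ, and consequently α₂ + (κ/2)·(Re(Y_∞⁺) − 1) = f/2 and α₁ + (κ/2)·(Re(1/Y_∞⁺) − 1) = f/2. -/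
theorem Complex.re_eq_sqrt_of_sq {w : ℂ} {p q : ℝ} (hp : (w ^ 2).re = p) (hq : (w ^ 2).im = q)
    (hw : 0 ≤ w.re) : w.re = √((√(q ^ 2 + p ^ 2) + p) / 2) := by
  simp only [sq, Complex.mul_re, Complex.mul_im] at hp hq
  have hnorm : √(q ^ 2 + p ^ 2) = w.re ^ 2 + w.im ^ 2 := by
    rw [← Real.sqrt_sq (by positivity : 0 ≤ w.re ^ 2 + w.im ^ 2), ← hp, ← hq]
    congr 1
    ring
  have hre : (√(q ^ 2 + p ^ 2) + p) / 2 = w.re ^ 2 := by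
    rw [hnorm, ← hp]
    ring
  rw [hre, Real.sqrt_sq hw]

theorem inv_add_div_of_sq_eq {K : Type*} [Field K] {w b k : K} (hk : k ≠ 0)
    (hw : w ^ 2 = b ^ 2 + k ^ 2) : ((b + w) / k)⁻¹ = (w - b) / k := by
  refine inv_eq_of_mul_eq_one_right ?_
  rw [div_mul_div_comm, div_eq_one_iff_eq (mul_ne_zero hk hk)]
  linear_combination hw

/-- Real parts of the attracting Riccati equilibrium `Y_∞⁺ = (a + iγ + w)/κ` and the
effective Hopf parameters of the two oscillators at the phase-locked state, expressed in
terms of the Active/Amplitude-Death transition function `f`. -/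
theorem SL_transition_function_and_effective_Hopf (α₁ α₂ κ γ : ℝ) (hα : α₂ < α₁)
    (hκ : 0 < κ) (hγ : 0 < γ) (a A f : ℝ)
    (ha : a = α₁ - α₂)
    (hA : A = Real.sqrt ((Real.sqrt (4 * a ^ 2 * γ ^ 2 + (a ^ 2 - γ ^ 2 + κ ^ 2) ^ 2)
        + a ^ 2 - γ ^ 2 + κ ^ 2) / 2))
    (hf : f = α₁ + α₂ - κ + A)
    (w : ℂ) (hw : w ^ 2 = ((a : ℂ) + Complex.I * γ) ^ 2 + (κ : ℂ) ^ 2) (hwre : 0 < w.re)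
    (Y : ℂ) (hY : Y = ((a : ℂ) + Complex.I * γ + w) / κ) :
    w.re = A ∧
    Y.re = (a + A) / κ ∧
    (Y⁻¹).re = (A - a) / κ ∧
    α₂ + (κ / 2) * (Y.re - 1) = f / 2 ∧
    α₁ + (κ / 2) * ((Y⁻¹).re - 1) = f / 2 := by
  have hre : w.re = A := by
    have h := Complex.re_eq_sqrt_of_sq (w := w) (p := a ^ 2 - γ ^ 2 + κ ^ 2) (q := 2 * a * γ)
      (by rw [hw]; simp [sq]) (by rw [hw]; simp [sq]; ring) hwre.le
    rw [h, hA]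
    ring_nf
  have hYre : Y.re = (a + A) / κ := by
    simp [hY, hre]
  have hYinv : (Y⁻¹).re = (A - a) / κ := by
    rw [hY, inv_add_div_of_sq_eq (Complex.ofReal_ne_zero.mpr hκ.ne') hw]
    simp [hre]
  refine ⟨hre, hYre, hYinv, ?_, ?_⟩
  · rw [hYre, hf, ha]
    field_simp
    ring
  · rw [hYinv, hf, ha]
    field_simp
    ring
end

section
/- Let α₁ > 0 ≥ α₂, 0 < κ ≤ 2α₁, and γ > 0. Define x⁻ = 1 if κ ≥ γ, and x⁻ = (γ + √(γ² − κ²))/κ if κ < γ. Define g(x) = √(1 − (2γ/(κ·(x + 1/x)))²) and h(x) = (x³·(κ − 2α₂) + x·(2α₁ − κ)) / (κ·(x⁴ − 1)). Then there exists a unique x ∈ (x⁻, ∞) with g(x) = h(x). -/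
/-- The left-hand side of the amplitude-ratio equation is monotone to the right of `1`. -/
lemma sqrt_one_sub_sq_mono {κ γ x y : ℝ} (hκ : 0 < κ) (hγ : 0 < γ) (hx : 1 < x) (hxy : x < y) :
    Real.sqrt (1 - (2 * γ / (κ * (x + 1 / x))) ^ 2)
      ≤ Real.sqrt (1 - (2 * γ / (κ * (y + 1 / y))) ^ 2) := by
  have hx0 : 0 < x := by linarith
  have hy0 : 0 < y := by linarith
  have hsum : x + 1 / x ≤ y + 1 / y := by
    have h : y + 1 / y - (x + 1 / x) = (y - x) * (x * y - 1) / (x * y) := by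
      field_simp
      ring
    have h' : 0 ≤ (y - x) * (x * y - 1) / (x * y) :=
      div_nonneg (mul_nonneg (by linarith) (by nlinarith)) (by positivity)
    linarith
  apply Real.sqrt_le_sqrt
  gcongr

/-- The right-hand side of the amplitude-ratio equation is strictly decreasing to the right
of `1`. -/
lemma cubic_div_quartic_strictAnti {κ a b x y : ℝ} (hκ : 0 < κ) (ha : 0 < a) (hb : 0 ≤ b)
    (hx : 1 < x) (hxy : x < y) :
    (y ^ 3 * a + y * b) / (κ * (y ^ 4 - 1)) < (x ^ 3 * a + x * b) / (κ * (x ^ 4 - 1)) := by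
  have hx0 : 0 < x := by linarith
  have hy0 : 0 < y := by linarith
  have hx4 : 0 < x ^ 4 - 1 := sub_pos.2 (one_lt_pow₀ hx (by norm_num))
  have hy4 : 0 < y ^ 4 - 1 := sub_pos.2 (one_lt_pow₀ (hx.trans hxy) (by norm_num))
  rw [div_lt_div_iff₀ (by positivity) (by positivity)]
  have hd : 0 < y - x := by linarith
  have h₁ : 0 < a * κ * ((y - x) * (x ^ 3 * y ^ 3 + y ^ 2 + x * y + x ^ 2)) := by positivity
  have h₂ : 0 ≤ b * κ * ((y - x) * (x * y * (y ^ 2 + x * y + x ^ 2) + 1)) := by positivity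
  nlinarith

/-- The threshold `x⁻` is at least `1` and at most `1 + 2γ/κ`, and the left-hand side, multiplied
by `x ^ 4 - 1`, vanishes there. -/
lemma threshold_spec {κ γ : ℝ} (hκ : 0 < κ) (hγ : 0 < γ) {m : ℝ}
    (hm : m = if γ ≤ κ then (1 : ℝ) else (γ + Real.sqrt (γ ^ 2 - κ ^ 2)) / κ) :
    1 ≤ m ∧ m ≤ 1 + 2 * γ / κ ∧
      Real.sqrt (1 - (2 * γ / (κ * (m + 1 / m))) ^ 2) * (κ * (m ^ 4 - 1)) = 0 := by
  split_ifs at hm with h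
  · subst hm
    exact ⟨le_rfl, le_add_of_nonneg_right (by positivity), by norm_num⟩
  · push Not at h
    have hs0 := Real.sqrt_nonneg (γ ^ 2 - κ ^ 2)
    have hs := Real.sq_sqrt (show 0 ≤ γ ^ 2 - κ ^ 2 by nlinarith)
    set s := Real.sqrt (γ ^ 2 - κ ^ 2)
    have hsγ : s ≤ γ := by nlinarith
    have hm1 : 1 ≤ m := by
      rw [hm, le_div_iff₀ hκ]
      linarith
    have hm2 : m ≤ 2 * γ / κ := by
      rw [hm]
      gcongr
      linarith
    have hg : 0 < γ + s := by linarith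
    have hsum : κ * (m + 1 / m) = 2 * γ := by
      rw [hm]
      field_simp
      nlinarith
    refine ⟨hm1, by linarith, ?_⟩
    rw [hsum, div_self (by positivity)]
    simp

/-- Leader-driven synchronization: for `α₁ > 0 ≥ α₂`, `0 < κ ≤ 2α₁` and any `γ > 0`,
the equation `g(x) = h(x)` determining the amplitude ratio of the active phase-locked
state has a unique solution `x > x⁻`. -/
theorem leader_driven_unique_amplitude_ratio (α₁ α₂ κ γ : ℝ)
    (h1 : 0 < α₁) (h2 : α₂ ≤ 0) (hκ0 : 0 < κ) (hκ : κ ≤ 2 * α₁) (hγ : 0 < γ) :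
    ∃! x : ℝ,
      (if γ ≤ κ then (1 : ℝ) else (γ + Real.sqrt (γ ^ 2 - κ ^ 2)) / κ) < x ∧
      Real.sqrt (1 - (2 * γ / (κ * (x + 1 / x))) ^ 2)
        = (x ^ 3 * (κ - 2 * α₂) + x * (2 * α₁ - κ)) / (κ * (x ^ 4 - 1)) := by
  obtain ⟨hm1, hm2, hm3⟩ := threshold_spec hκ0 hγ rfl
  set m := if γ ≤ κ then (1 : ℝ) else (γ + Real.sqrt (γ ^ 2 - κ ^ 2)) / κ
  have ha : 0 < κ - 2 * α₂ := by linarith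
  have hb : 0 ≤ 2 * α₁ - κ := by linarith
  set a := κ - 2 * α₂
  set b := 2 * α₁ - κ
  refine existsUnique_of_exists_of_unique ?_ ?_
  · set F : ℝ → ℝ := fun x =>
      Real.sqrt (1 - (2 * γ / (κ * (x + 1 / x))) ^ 2) * (κ * (x ^ 4 - 1)) - (x ^ 3 * a + x * b)
      with hF
    set X := 2 + 4 * γ / κ + 4 * (a + b) / κ with hX
    have hγκ : 0 < γ / κ := by positivity
    have habκ : 0 < 4 * (a + b) / κ := by positivity
    have hγ2 : 2 * γ / κ = 2 * (γ / κ) := by ring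
    have hγ4 : 4 * γ / κ = 4 * (γ / κ) := by ring
    have hX2 : 2 ≤ X := by linarith
    have hmX : m ≤ X := by linarith
    have hX0 : 0 < X := by linarith
    have hXγ : 4 * γ ≤ κ * X := by
      rw [mul_comm κ, ← div_le_iff₀ hκ0]
      linarith
    have hXab : 4 * (a + b) < κ * X := by
      rw [mul_comm κ, ← div_lt_iff₀ hκ0]
      linarith
    have hcont : ContinuousOn F (Set.Icc m X) := by
      have hne : ∀ x ∈ Set.Icc m X, x ≠ 0 := fun x hx => by linarith [hx.1]
      have hne' : ∀ x ∈ Set.Icc m X, κ * (x + 1 / x) ≠ 0 := fun x hx => by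
        have : 0 < x := by linarith [hx.1]
        positivity
      fun_prop (disch := assumption)
    have hFm : F m < 0 := by
      have : 0 < m ^ 3 * a + m * b := by positivity
      simp only [hF, hm3]
      linarith
    have hFX : 0 < F X := by
      have hsqrt : 1 / 2 ≤ Real.sqrt (1 - (2 * γ / (κ * (X + 1 / X))) ^ 2) := by
        apply Real.le_sqrt_of_sq_le
        have hle : 2 * γ / (κ * (X + 1 / X)) ≤ 1 / 2 := by
          have hinv : 0 < κ * (1 / X) := by positivity
          rw [div_le_iff₀ (by positivity)]
          linarith
        have hnn : 0 ≤ 2 * γ / (κ * (X + 1 / X)) := by positivity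
        nlinarith
      have hX3 : 8 ≤ X ^ 3 := by
        calc (8 : ℝ) = 2 ^ 3 := by norm_num
          _ ≤ X ^ 3 := by gcongr
      have hX4 : X ^ 4 / 2 ≤ X ^ 4 - 1 := by nlinarith
      have hlow : 1 / 2 * (κ * (X ^ 4 / 2)) ≤
          Real.sqrt (1 - (2 * γ / (κ * (X + 1 / X))) ^ 2) * (κ * (X ^ 4 - 1)) := by
        gcongr
      have hbX : X * b ≤ X ^ 3 * b := by
        gcongr
        exact le_self_pow₀ (by linarith) (by norm_num)
      have hdom : X ^ 3 * (4 * (a + b)) < X ^ 3 * (κ * X) := by gcongr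
      simp only [hF]
      nlinarith
    obtain ⟨x, hx, hx0⟩ := intermediate_value_Ioo hmX hcont ⟨hFm, hFX⟩
    have hx4 : 0 < x ^ 4 - 1 := sub_pos.2 (one_lt_pow₀ (hm1.trans_lt hx.1) (by norm_num))
    refine ⟨x, hx.1, ?_⟩
    rw [eq_div_iff (by positivity)]
    simp only [hF] at hx0
    linarith
  · rintro x y ⟨hx, hxe⟩ ⟨hy, hye⟩
    rcases lt_trichotomy x y with h | h | h
    · have := sqrt_one_sub_sq_mono hκ0 hγ (hm1.trans_lt hx) h
      have := cubic_div_quartic_strictAnti hκ0 ha hb (hm1.trans_lt hx) h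
      linarith
    · exact h
    · have := sqrt_one_sub_sq_mono hκ0 hγ (hm1.trans_lt hy) h
      have := cubic_div_quartic_strictAnti hκ0 ha hb (hm1.trans_lt hy) h
      linarith
end

section
/- Let α₁ > α₂ > 0, 0 < κ < 2α₂, γ > 0, and set a = α₁ − α₂. Define R = √((2α₁ − κ)/(2α₂ − κ)), l = a, Φ = π/2, r₂² = l/(R² − 1) and r₁² = R²·r₂². Then the triple (l, R, Φ) satisfies the three stationarity equations 0 = (a − l)·R + (κ/2)·cos(Φ)·(1 − R²), 0 = γ − (κ/2)·(R + 1/R)·sin(Φ), and 0 = 2·(α₁·r₁² − α₂·r₂²) − l·(κ + 2·(r₁² + r₂²)) if and only if γ = κ·(α₁ + α₂ − κ)/√((2α₁ − κ)·(2α₂ − κ)). -/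
/-- The triple `(l, R, Φ) = (a, √((2α₁−κ)/(2α₂−κ)), π/2)` is stationary for the
two-oscillator Stuart–Landau relative dynamics if and only if `γ` lies on the
phase-locking/incoherence transition curve `γ*(κ)`. -/
theorem phase_locking_incoherence_curve (α₁ α₂ κ γ : ℝ) (h21 : α₂ < α₁) (h2 : 0 < α₂)
    (hκ0 : 0 < κ) (hκ : κ < 2 * α₂) (hγ : 0 < γ)
    (a R l Φ r1sq r2sq : ℝ)
    (ha : a = α₁ - α₂)
    (hR : R = Real.sqrt ((2 * α₁ - κ) / (2 * α₂ - κ)))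
    (hl : l = a)
    (hΦ : Φ = Real.pi / 2)
    (hr2 : r2sq = l / (R ^ 2 - 1))
    (hr1 : r1sq = R ^ 2 * r2sq) :
    ((0 : ℝ) = (a - l) * R + (κ / 2) * Real.cos Φ * (1 - R ^ 2) ∧
     (0 : ℝ) = γ - (κ / 2) * (R + 1 / R) * Real.sin Φ ∧
     (0 : ℝ) = 2 * (α₁ * r1sq - α₂ * r2sq) - l * (κ + 2 * (r1sq + r2sq)))
    ↔ γ = κ * (α₁ + α₂ - κ) / Real.sqrt ((2 * α₁ - κ) * (2 * α₂ - κ)) := by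
  have hq : 0 < 2 * α₂ - κ := by linarith
  have hp : 0 < 2 * α₁ - κ := by linarith
  have had : 0 < α₁ - α₂ := sub_pos.2 h21
  have hR2 : R ^ 2 = (2 * α₁ - κ) / (2 * α₂ - κ) := by
    rw [hR, Real.sq_sqrt (div_pos hp hq).le]
  have hR2_sub : R ^ 2 - 1 = 2 * (α₁ - α₂) / (2 * α₂ - κ) := by
    rw [hR2]
    field_simp
    ring
  have hr2sq : r2sq = (2 * α₂ - κ) / 2 := by
    rw [hr2, hR2_sub, hl, ha]
    field_simp [had.ne', hq.ne']
  have hr1sq : r1sq = (2 * α₁ - κ) / 2 := by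
    rw [hr1, hR2, hr2sq]
    field_simp
  have hcoupling : κ / 2 * (R + 1 / R) =
      κ * (α₁ + α₂ - κ) / √((2 * α₁ - κ) * (2 * α₂ - κ)) := by
    rw [hR, Real.sqrt_div hp.le, Real.sqrt_mul hp.le]
    have hsp := Real.sqrt_pos.2 hp
    have hsq := Real.sqrt_pos.2 hq
    field_simp
    rw [Real.sq_sqrt hp.le, Real.sq_sqrt hq.le]
    ring
  rw [hΦ, Real.cos_pi_div_two, Real.sin_pi_div_two, mul_one, hcoupling]
  constructor
  · rintro ⟨-, h, -⟩
    linarith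
  · intro h
    refine ⟨?_, ?_, ?_⟩
    · rw [hl]
      ring
    · linarith
    · rw [hr1sq, hr2sq, hl, ha]
      ring
end

section
/- Let N ≥ 1, κ > 0 and α₁,…,α_N ∈ ℝ with κ > α_j for every j and Σ_{j=1}^N α_j/(κ − α_j) < 0. Then the N×N real symmetric matrix A defined by A_{jj} = κ − α_j − κ/N and A_{jk} = −κ/N for j ≠ k (that is, A = diag(κ − α₁,…,κ − α_N) − (κ/N)·J where J is the all-ones matrix) is positive definite. -/
/-- The Jacobian at the origin of the (negated) amplitude vector field of the
frequency-homogeneous coupled Stuart–Landau system. -/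
noncomputable def deathJacobian (N : ℕ) (κ : ℝ) (α : Fin N → ℝ) : Matrix (Fin N) (Fin N) ℝ :=
  Matrix.of fun j k => if j = k then κ - α j - κ / N else -(κ / N)

theorem deathJacobian_isHermitian (N : ℕ) (κ : ℝ) (α : Fin N → ℝ) :
    (deathJacobian N κ α).IsHermitian := by
  refine Matrix.IsHermitian.ext fun i j => ?_
  by_cases h : i = j
  · subst h
    rfl
  · simp [deathJacobian, h, Ne.symm h]

theorem dotProduct_deathJacobian_mulVec (N : ℕ) (κ : ℝ) (α x : Fin N → ℝ) :
    dotProduct x ((deathJacobian N κ α).mulVec x) =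
      ∑ j, (κ - α j) * x j ^ 2 - κ / N * (∑ j, x j) ^ 2 := by
  have hA : deathJacobian N κ α =
      Matrix.diagonal (fun j => κ - α j) - Matrix.of fun _ _ => κ / (N : ℝ) := by
    ext i j
    by_cases h : i = j
    · subst h
      simp [deathJacobian]
    · simp [deathJacobian, h]
  rw [hA, Matrix.sub_mulVec, dotProduct_sub]
  congr 1
  · simp only [dotProduct, Matrix.mulVec_diagonal]
    exact Finset.sum_congr rfl fun j _ => by ring
  · simp only [dotProduct, Matrix.mulVec, Matrix.of_apply, ← Finset.mul_sum, ← Finset.sum_mul]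
    ring

theorem mul_sum_inv_sub_lt (N : ℕ) (κ : ℝ) (α : Fin N → ℝ) (hα : ∀ j, α j < κ)
    (hsum : ∑ j, α j / (κ - α j) < 0) : κ * ∑ j, (κ - α j)⁻¹ < N := by
  have h : κ * ∑ j, (κ - α j)⁻¹ = N + ∑ j, α j / (κ - α j) := by
    rw [Finset.mul_sum]
    calc ∑ j, κ * (κ - α j)⁻¹ = ∑ j, (1 + α j / (κ - α j)) := by
          refine Finset.sum_congr rfl fun j _ => ?_
          have := (sub_pos.2 (hα j)).ne'
          field_simp
          ring
      _ = _ := by simp [Finset.sum_add_distrib]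
  linarith

/-- Stability criterion for the Amplitude Death fixed point: if `κ > α_j` for every `j`
and `Σ_j α_j/(κ − α_j) < 0`, the Jacobian at the origin is positive definite. -/
theorem amplitude_death_jacobian_posDef (N : ℕ) (hN : 1 ≤ N) (κ : ℝ) (hκ : 0 < κ)
    (α : Fin N → ℝ) (hα : ∀ j, α j < κ)
    (hsum : ∑ j, α j / (κ - α j) < 0) :
    (deathJacobian N κ α).PosDef := by
  refine Matrix.posDef_iff_dotProduct_mulVec.2 ⟨deathJacobian_isHermitian N κ α, fun x hx => ?_⟩
  rw [star_trivial, dotProduct_deathJacobian_mulVec, sub_pos]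
  have hd : ∀ j, 0 < κ - α j := fun j => sub_pos.2 (hα j)
  obtain ⟨i, hi⟩ := Function.ne_iff.1 hx
  have hQ : 0 < ∑ j, (κ - α j) * x j ^ 2 :=
    Finset.sum_pos' (fun j _ => mul_nonneg (hd j).le (sq_nonneg _))
      ⟨i, Finset.mem_univ i, mul_pos (hd i) (sq_pos_iff.2 hi)⟩
  have hCS : (∑ j, x j) ^ 2 ≤ (∑ j, (κ - α j) * x j ^ 2) * ∑ j, (κ - α j)⁻¹ :=
    Finset.sum_sq_le_sum_mul_sum_of_sq_le_mul _
      (fun j _ => mul_nonneg (hd j).le (sq_nonneg _)) (fun j _ => (inv_pos.2 (hd j)).le)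
      fun j _ => by
        have := (hd j).ne'
        apply le_of_eq
        field_simp
  have hN' : (0 : ℝ) < N := by exact_mod_cast hN
  rw [div_mul_eq_mul_div, div_lt_iff₀ hN']
  calc κ * (∑ j, x j) ^ 2
      ≤ κ * ((∑ j, (κ - α j) * x j ^ 2) * ∑ j, (κ - α j)⁻¹) := by gcongr
    _ = (∑ j, (κ - α j) * x j ^ 2) * (κ * ∑ j, (κ - α j)⁻¹) := by ring
    _ < (∑ j, (κ - α j) * x j ^ 2) * N :=
      mul_lt_mul_of_pos_left (mul_sum_inv_sub_lt N κ α hα hsum) hQ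
end

section
/- Let N ≥ 1, κ > 0 and α₁,…,α_N ∈ ℝ with κ > α_j for every j and Σ_{j=1}^N α_j/(κ − α_j) > 0. Then the N×N real matrix A defined by A_{jj} = κ − α_j − κ/N and A_{jk} = −κ/N for j ≠ k satisfies det(A) < 0; in particular A has a negative real eigenvalue, so the Amplitude Death fixed point is unstable. -/
/-- The determinant of the Jacobian, a rank-one perturbation of a diagonal matrix. -/
theorem deathJacobian_det (N : ℕ) (κ : ℝ) (α : Fin N → ℝ) (hα : ∀ j, κ - α j ≠ 0) :
    (deathJacobian N κ α).det =
      (∏ j, (κ - α j)) * (1 - κ / N * ∑ j, 1 / (κ - α j)) := by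
  have hfac : deathJacobian N κ α = Matrix.diagonal (fun j => κ - α j) *
      (1 + Matrix.replicateCol Unit (fun j => -(κ / N) / (κ - α j)) *
        Matrix.replicateRow Unit (fun _ => (1 : ℝ))) := by
    ext j k
    rw [Matrix.diagonal_mul]
    simp only [deathJacobian, Matrix.of_apply, Matrix.add_apply, Matrix.one_apply,
      Matrix.mul_apply, Matrix.replicateCol_apply, Matrix.replicateRow_apply,
      Finset.univ_unique, Finset.sum_singleton, mul_one, mul_add, mul_div_cancel₀ _ (hα j)]
    split_ifs <;> ring
  rw [hfac, Matrix.det_mul, Matrix.det_diagonal,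
    Matrix.det_one_add_replicateCol_mul_replicateRow]
  congr 1
  simp only [dotProduct, one_mul, Finset.mul_sum, sub_eq_add_neg, ← Finset.sum_neg_distrib]
  congr 1
  exact Finset.sum_congr rfl fun j _ => by ring

/-- A real symmetric matrix with negative determinant has a negative eigenvalue. -/
theorem Matrix.IsHermitian.exists_neg_hasEigenvalue_of_det_neg {n : Type*} [Fintype n]
    [DecidableEq n] {A : Matrix n n ℝ} (hA : A.IsHermitian) (hdet : A.det < 0) :
    ∃ μ : ℝ, μ < 0 ∧ Module.End.HasEigenvalue (Matrix.toLin' A) μ := by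
  have hex : ∃ i, hA.eigenvalues i < 0 := by
    by_contra! h
    refine hdet.not_ge ?_
    rw [hA.det_eq_prod_eigenvalues]
    exact Finset.prod_nonneg fun i _ => by simpa using h i
  obtain ⟨i, hi⟩ := hex
  refine ⟨_, hi, Module.End.hasEigenvalue_of_hasEigenvector
    (x := (hA.eigenvectorBasis i).ofLp) ⟨?_, fun h => ?_⟩⟩
  · rw [Module.End.mem_eigenspace_iff, Matrix.toLin'_apply]
    exact hA.mulVec_eigenvectorBasis i
  · exact hA.eigenvectorBasis.orthonormal.ne_zero i (by ext j; simpa using congrFun h j)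

/-- Instability criterion for the Amplitude Death fixed point: if `κ > α_j` for every `j`
and `Σ_j α_j/(κ − α_j) > 0`, the Jacobian at the origin has negative determinant, hence
a negative real eigenvalue. -/
theorem amplitude_death_jacobian_det_neg (N : ℕ) (hN : 1 ≤ N) (κ : ℝ) (hκ : 0 < κ)
    (α : Fin N → ℝ) (hα : ∀ j, α j < κ)
    (hsum : 0 < ∑ j, α j / (κ - α j)) :
    (deathJacobian N κ α).det < 0 ∧
    ∃ μ : ℝ, μ < 0 ∧
      Module.End.HasEigenvalue (Matrix.toLin' (deathJacobian N κ α)) μ := by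
  have hN0 : (0 : ℝ) < N := by exact_mod_cast hN
  have hdet : (deathJacobian N κ α).det < 0 := by
    rw [deathJacobian_det N κ α fun j => (sub_pos.2 (hα j)).ne']
    refine mul_neg_of_pos_of_neg (Finset.prod_pos fun j _ => sub_pos.2 (hα j)) ?_
    have hκsum : κ * ∑ j, 1 / (κ - α j) = N + ∑ j, α j / (κ - α j) := by
      have hterm : ∀ j, κ * (1 / (κ - α j)) = 1 + α j / (κ - α j) := fun j => by
        have := (sub_pos.2 (hα j)).ne'
        field_simp
        ring
      simp [Finset.mul_sum, hterm, Finset.sum_add_distrib, -one_div]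
    rw [sub_neg, div_mul_eq_mul_div, hκsum, lt_div_iff₀ hN0]
    linarith
  exact ⟨hdet, (deathJacobian_isHermitian N κ α).exists_neg_hasEigenvalue_of_det_neg hdet⟩
end

section
/- Let N ≥ 2, κ > 0 and α₁,…,α_N ∈ ℝ with Σ_{j=1}^N α_j > 0. Then there exists exactly one point x = (x₁,…,x_N) ∈ ℝ^N with x_j > 0 for every j satisfying, for every j, (α_j − x_j²)·x_j + (κ/N)·Σ_{l=1}^N (x_l − x_j) = 0. -/
/-- The potential whose negative gradient is the real-line Stuart–Landau vector field. -/
noncomputable def stuartLandauPotential {N : ℕ} (κ : ℝ) (α x : Fin N → ℝ) : ℝ :=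
  ∑ i, ((x i) ^ 4 / 4 - (α i - κ) * (x i) ^ 2 / 2) - κ / N * (∑ i, x i) ^ 2 / 2

theorem continuous_stuartLandauPotential {N : ℕ} (κ : ℝ) (α : Fin N → ℝ) :
    Continuous (stuartLandauPotential κ α) := by
  unfold stuartLandauPotential
  fun_prop

theorem hasDerivAt_stuartLandauPotential {N : ℕ} (κ : ℝ) (α x v : Fin N → ℝ) :
    HasDerivAt (fun t : ℝ => stuartLandauPotential κ α (fun i => x i + t * v i))
      (∑ i, ((x i) ^ 3 - (α i - κ) * x i) * v i - κ / N * (∑ i, x i) * ∑ i, v i) 0 := by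
  have hline (i : Fin N) : HasDerivAt (fun t : ℝ => x i + t * v i) (v i) 0 := by
    simpa using ((hasDerivAt_id (0 : ℝ)).mul_const (v i)).const_add (x i)
  have hlocal := HasDerivAt.fun_sum (u := Finset.univ) fun i _ =>
    (((hline i).fun_pow 4).div_const 4).fun_sub
      ((((hline i).fun_pow 2).const_mul (α i - κ)).div_const 2)
  have hsum := HasDerivAt.fun_sum (u := Finset.univ) fun i _ => hline i
  have hcoupling := ((hsum.fun_pow 2).const_mul (κ / N)).div_const 2
  refine (hlocal.fun_sub hcoupling).congr_deriv ?_
  congr 1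
  · refine Finset.sum_congr rfl fun i _ => ?_
    norm_num
    ring
  · norm_num
    ring

theorem stuartLandauPotential_lower_bound {N : ℕ} (hN : 0 < N) {κ : ℝ} (hκ : 0 ≤ κ)
    (α x : Fin N → ℝ) :
    ∑ i, (x i) ^ 2 - ∑ i, (α i + 2) ^ 2 / 4 ≤ stuartLandauPotential κ α x := by
  have hN' : (0 : ℝ) < N := by exact_mod_cast hN
  have hcs : (∑ i, x i) ^ 2 ≤ N * ∑ i, (x i) ^ 2 := by
    simpa using sq_sum_le_card_mul_sum_sq (s := Finset.univ) (f := x)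
  have hcoupling : κ / N * (∑ i, x i) ^ 2 ≤ κ * ∑ i, (x i) ^ 2 := by
    calc κ / N * (∑ i, x i) ^ 2 ≤ κ / N * (N * ∑ i, (x i) ^ 2) := by gcongr
      _ = κ * ∑ i, (x i) ^ 2 := by field_simp
  have hlocal : ∑ i, ((x i) ^ 2 - (α i + 2) ^ 2 / 4) ≤
      ∑ i, ((x i) ^ 4 / 4 - (α i - κ) * (x i) ^ 2 / 2 - κ / 2 * (x i) ^ 2) :=
    Finset.sum_le_sum fun i _ => by nlinarith [sq_nonneg ((x i) ^ 2 - (α i + 2))]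
  rw [Finset.sum_sub_distrib, Finset.sum_sub_distrib, ← Finset.mul_sum] at hlocal
  unfold stuartLandauPotential
  linarith

theorem exists_forall_stuartLandauPotential_le {N : ℕ} (hN : 0 < N) {κ : ℝ} (hκ : 0 ≤ κ)
    (α : Fin N → ℝ) :
    ∃ x, ∀ y, stuartLandauPotential κ α x ≤ stuartLandauPotential κ α y := by
  refine (continuous_stuartLandauPotential κ α).exists_forall_le' 0 ?_
  set D := ∑ i, (α i + 2) ^ 2 / 4
  have hD : 0 ≤ D := Finset.sum_nonneg fun i _ => by positivity
  filter_upwards [(tendsto_norm_cocompact_atTop (E := Fin N → ℝ)).eventually_ge_atTop (D + 1)]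
    with x hx
  have hnorm : ‖x‖ ≤ ∑ i, (x i) ^ 2 + 1 := by
    have h0 : 0 ≤ ∑ i, (x i) ^ 2 := Finset.sum_nonneg fun i _ => sq_nonneg _
    refine (pi_norm_le_iff_of_nonneg (by linarith)).2 fun i => ?_
    have hi := Finset.single_le_sum (f := fun i => (x i) ^ 2) (fun i _ => sq_nonneg _)
      (Finset.mem_univ i)
    rw [Real.norm_eq_abs]
    nlinarith [sq_nonneg (|x i| - 1), sq_abs (x i), abs_nonneg (x i)]
  have hzero : stuartLandauPotential κ α 0 = 0 := by simp [stuartLandauPotential]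
  rw [hzero]
  linarith [stuartLandauPotential_lower_bound hN hκ α x]

theorem stuartLandauPotential_abs_le {N : ℕ} {κ : ℝ} (hκ : 0 ≤ κ) (α x : Fin N → ℝ) :
    stuartLandauPotential κ α (fun i => |x i|) ≤ stuartLandauPotential κ α x := by
  have hsq : (∑ i, x i) ^ 2 ≤ (∑ i, |x i|) ^ 2 :=
    sq_le_sq.2 ((Finset.abs_sum_le_sum_abs _ _).trans (le_abs_self _))
  have hcoupling : κ / N * (∑ i, x i) ^ 2 ≤ κ / N * (∑ i, |x i|) ^ 2 := by gcongr
  have h4 (i : Fin N) : |x i| ^ 4 = (x i) ^ 4 := (by decide : Even 4).pow_abs _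
  simp only [stuartLandauPotential, sq_abs, h4]
  linarith

theorem stuartLandauPotential_critical_of_min {N : ℕ} {κ : ℝ} {α x : Fin N → ℝ}
    (hx : ∀ y, stuartLandauPotential κ α x ≤ stuartLandauPotential κ α y) (j : Fin N) :
    x j * ((x j) ^ 2 - (α j - κ)) = κ / N * ∑ i, x i := by
  have hmin : IsLocalMin
      (fun t : ℝ => stuartLandauPotential κ α (fun i => x i + t * (Pi.single j 1 : Fin N → ℝ) i))
      0 := by
    refine Filter.Eventually.of_forall fun t => ?_
    simpa using hx _
  have h := hmin.hasDerivAt_eq_zero (hasDerivAt_stuartLandauPotential κ α x (Pi.single j 1))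
  simp [Pi.single_apply] at h
  linarith

theorem exists_stuartLandauPotential_neg {N : ℕ} (hN : 0 < N) (κ : ℝ) {α : Fin N → ℝ}
    (hsum : 0 < ∑ j, α j) : ∃ x, stuartLandauPotential κ α x < 0 := by
  have hN' : (0 : ℝ) < N := by exact_mod_cast hN
  set t := √((∑ j, α j) / N)
  have ht : t ^ 2 = (∑ j, α j) / N := Real.sq_sqrt (by positivity)
  have hNt : N * t ^ 2 = ∑ j, α j := by rw [ht]; field_simp
  have ht0 : 0 < t ^ 2 := by rw [ht]; positivity
  refine ⟨fun _ => t, ?_⟩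
  have heq : stuartLandauPotential κ α (fun _ => t) =
      N * t ^ 4 / 4 - (∑ j, α j) * t ^ 2 / 2 := by
    simp only [stuartLandauPotential, Finset.sum_sub_distrib, ← Finset.sum_div,
      ← Finset.sum_mul, Finset.sum_const, Finset.card_univ, Fintype.card_fin, nsmul_eq_mul]
    field_simp
    ring
  rw [heq]
  nlinarith [mul_pos hsum ht0]

theorem stuartLandau_equilibrium_iff {N : ℕ} (hN : 0 < N) (κ : ℝ) (α x : Fin N → ℝ)
    (j : Fin N) :
    (α j - (x j) ^ 2) * x j + (κ / N) * ∑ l, (x l - x j) = 0 ↔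
      x j * ((x j) ^ 2 - (α j - κ)) = κ / N * ∑ i, x i := by
  have hN' : (N : ℝ) ≠ 0 := by exact_mod_cast hN.ne'
  have hcancel : κ / N * (N * x j) = κ * x j := by field_simp
  simp only [Finset.sum_sub_distrib, Finset.sum_const, Finset.card_univ, Fintype.card_fin,
    nsmul_eq_mul, mul_sub, hcancel]
  constructor <;> intro h <;> linarith

theorem exists_pos_stuartLandau_equilibrium {N : ℕ} (hN : 0 < N) {κ : ℝ} (hκ : 0 < κ)
    {α : Fin N → ℝ} (hsum : 0 < ∑ j, α j) :
    ∃ x : Fin N → ℝ, (∀ j, 0 < x j) ∧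
      ∀ j, x j * ((x j) ^ 2 - (α j - κ)) = κ / N * ∑ i, x i := by
  have hN' : (0 : ℝ) < N := by exact_mod_cast hN
  obtain ⟨z, hz⟩ := exists_forall_stuartLandauPotential_le hN hκ.le α
  set x : Fin N → ℝ := fun i => |z i|
  have hx y : stuartLandauPotential κ α x ≤ stuartLandauPotential κ α y :=
    (stuartLandauPotential_abs_le hκ.le α z).trans (hz y)
  have hx0 j : 0 ≤ x j := abs_nonneg _
  have hcrit := stuartLandauPotential_critical_of_min hx
  refine ⟨x, fun j => (hx0 j).lt_of_ne fun hj => ?_, hcrit⟩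
  have hzero : ∑ i, x i = 0 := by
    have h := hcrit j
    rw [← hj, zero_mul] at h
    exact (mul_eq_zero.1 h.symm).resolve_left (by positivity)
  have hxzero : x = 0 :=
    funext fun i => (Finset.sum_eq_zero_iff_of_nonneg fun i _ => hx0 i).1 hzero i (Finset.mem_univ i)
  obtain ⟨y, hy⟩ := exists_stuartLandauPotential_neg hN κ hsum
  have h := hx y
  rw [hxzero] at h
  have h0 : stuartLandauPotential κ α 0 = 0 := by simp [stuartLandauPotential]
  linarith

/-- For positive solutions of `x (x² - β) = s` the ratio `x / s` is antitone in `s`. -/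
theorem mul_le_mul_of_cubic_eq {β x y s t : ℝ} (hx : 0 < x) (hy : 0 < y) (ht : 0 < t)
    (hst : s ≤ t) (hxs : x * (x ^ 2 - β) = s) (hyt : y * (y ^ 2 - β) = t) :
    y * s ≤ x * t := by
  have hypos : 0 < y ^ 2 - β := by
    by_contra! h
    nlinarith [mul_nonneg hy.le (neg_nonneg.2 h)]
  have hxy : x ≤ y := by
    by_contra! h
    have hsq : y ^ 2 < x ^ 2 := by gcongr
    have : y * (y ^ 2 - β) < x * (x ^ 2 - β) := by gcongr
    linarith
  have hsq : x ^ 2 ≤ y ^ 2 := by gcongr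
  have h := mul_le_mul_of_nonneg_left (sub_le_sub_right hsq β) (mul_pos hx hy).le
  rw [← hxs, ← hyt]
  linarith

theorem pos_stuartLandau_equilibrium_eq_of_sum_le {N : ℕ} (hN : 0 < N) {κ : ℝ} (hκ : 0 < κ)
    {α x y : Fin N → ℝ} (hx : ∀ j, 0 < x j) (hy : ∀ j, 0 < y j)
    (hxe : ∀ j, x j * ((x j) ^ 2 - (α j - κ)) = κ / N * ∑ i, x i)
    (hye : ∀ j, y j * ((y j) ^ 2 - (α j - κ)) = κ / N * ∑ i, y i)
    (hle : ∑ i, x i ≤ ∑ i, y i) : x = y := by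
  have hN' : (0 : ℝ) < N := by exact_mod_cast hN
  have : Nonempty (Fin N) := ⟨⟨0, hN⟩⟩
  have hysum : 0 < ∑ i, y i := Finset.sum_pos (fun i _ => hy i) Finset.univ_nonempty
  have hst : κ / N * ∑ i, x i ≤ κ / N * ∑ i, y i := by gcongr
  have hterm j := mul_le_mul_of_cubic_eq (hx j) (hy j) (by positivity) hst (hxe j) (hye j)
  have heq : ∑ j, y j * (κ / N * ∑ i, x i) = ∑ j, x j * (κ / N * ∑ i, y i) := by
    rw [← Finset.sum_mul, ← Finset.sum_mul]
    ring
  have hall := (Finset.sum_eq_sum_iff_of_le fun j _ => hterm j).1 heq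
  funext j
  have h := hall j (Finset.mem_univ j)
  rw [← hxe j, ← hye j] at h
  have hsq : (x j) ^ 2 = (y j) ^ 2 := by
    refine mul_left_cancel₀ (mul_pos (hx j) (hy j)).ne' ?_
    linarith
  exact (sq_eq_sq₀ (hx j).le (hy j).le).1 hsq

/-- Existence and uniqueness of the positive (Active) equilibrium of the real-line
reduction of the coupled Stuart–Landau system when `Σ_j α_j > 0`. -/
theorem SL_real_unique_positive_equilibrium (N : ℕ) (hN : 2 ≤ N) (κ : ℝ) (hκ : 0 < κ)
    (α : Fin N → ℝ) (hsum : 0 < ∑ j, α j) :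
    ∃! x : Fin N → ℝ, (∀ j, 0 < x j) ∧
      ∀ j, (α j - (x j) ^ 2) * x j + (κ / N) * ∑ l, (x l - x j) = 0 := by
  have hN0 : 0 < N := by omega
  simp only [stuartLandau_equilibrium_iff hN0]
  obtain ⟨x, hx, hxe⟩ := exists_pos_stuartLandau_equilibrium hN0 hκ hsum
  refine ⟨x, ⟨hx, hxe⟩, fun y hy => ?_⟩
  rcases le_total (∑ i, x i) (∑ i, y i) with h | h
  · exact (pos_stuartLandau_equilibrium_eq_of_sum_le hN0 hκ hx hy.1 hxe hy.2 h).symm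
  · exact pos_stuartLandau_equilibrium_eq_of_sum_le hN0 hκ hy.1 hx hy.2 hxe h
end

section
/- Let N ≥ 1, κ > 0 and α₁,…,α_N ∈ ℝ with κ > α_j for every j. If x = (x₁,…,x_N) ∈ ℝ^N satisfies, for every j, (α_j − x_j²)·x_j + (κ/N)·Σ_{l=1}^N (x_l − x_j) = 0, then either x_j ≥ 0 for all j or x_j ≤ 0 for all j; that is, for κ larger than every α_j no Disagreement equilibrium exists. -/
/-- For coupling strength larger than every stubbornness parameter, no Disagreement
equilibrium of the real-line Stuart–Landau opinion dynamics exists: every equilibrium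
has all coordinates of the same sign. -/
theorem SL_real_no_disagreement_equilibrium (N : ℕ) (hN : 1 ≤ N) (κ : ℝ) (hκ : 0 < κ)
    (α : Fin N → ℝ) (hα : ∀ j, α j < κ)
    (x : Fin N → ℝ)
    (hx : ∀ j, (α j - (x j) ^ 2) * x j + (κ / N) * ∑ l, (x l - x j) = 0) :
    (∀ j, 0 ≤ x j) ∨ (∀ j, x j ≤ 0) := by
  have hN' : (N : ℝ) ≠ 0 := Nat.cast_ne_zero.mpr (by omega)
  have key : ∀ j, (κ - α j + x j ^ 2) * x j = κ / N * ∑ l, x l := by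
    intro j
    have h := hx j
    rw [Finset.sum_sub_distrib, Finset.sum_const, Finset.card_univ, Fintype.card_fin,
      nsmul_eq_mul, mul_sub, ← mul_assoc, div_mul_cancel₀ κ hN'] at h
    linear_combination -h
  have hpos : ∀ j, 0 < κ - α j + x j ^ 2 := fun j =>
    add_pos_of_pos_of_nonneg (sub_pos.mpr (hα j)) (sq_nonneg _)
  rcases le_total 0 (κ / N * ∑ l, x l) with h | h
  · exact Or.inl fun j => nonneg_of_mul_nonneg_right ((key j).symm ▸ h) (hpos j)
  · exact Or.inr fun j => nonpos_of_mul_nonpos_right ((key j).symm ▸ h) (hpos j)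
end

section
/- Let α > 0 and κ > α. Then (x₁, x₂) ∈ ℝ² satisfies 0 = (α − x₁²)·x₁ + (κ/2)·(x₂ − x₁) and 0 = (α − x₂²)·x₂ + (κ/2)·(x₁ − x₂) if and only if (x₁, x₂) ∈ {(0,0), (√α, √α), (−√α, −√α)}; that is, after the final bifurcation at κ = α, the only equilibria of the two-agent system are the balanced state and the two consensus states. -/
/-- For two twin agents with stubbornness `α > 0` and coupling `κ > α`, the only
equilibria of the real-line Stuart–Landau opinion system are the balanced state `(0,0)`
and the two consensus states `(±√α, ±√α)`. -/
theorem SL_two_agent_equilibria_strong_coupling (α κ x₁ x₂ : ℝ) (hα : 0 < α)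
    (hκ : α < κ) :
    ((0 : ℝ) = (α - x₁ ^ 2) * x₁ + (κ / 2) * (x₂ - x₁) ∧
     (0 : ℝ) = (α - x₂ ^ 2) * x₂ + (κ / 2) * (x₁ - x₂))
    ↔ ((x₁ = 0 ∧ x₂ = 0) ∨
       (x₁ = Real.sqrt α ∧ x₂ = Real.sqrt α) ∨
       (x₁ = -Real.sqrt α ∧ x₂ = -Real.sqrt α)) := by
  have hs : Real.sqrt α ^ 2 = α := Real.sq_sqrt hα.le
  constructor
  · rintro ⟨h₁, h₂⟩
    have hprod : (x₁ - x₂) * (κ - α + (x₁ ^ 2 + x₁ * x₂ + x₂ ^ 2)) = 0 := by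
      linear_combination h₁ - h₂
    have hpos : 0 < κ - α + (x₁ ^ 2 + x₁ * x₂ + x₂ ^ 2) := by
      nlinarith [sq_nonneg (x₁ + x₂), sq_nonneg x₁, sq_nonneg x₂]
    obtain rfl : x₁ = x₂ :=
      sub_eq_zero.mp ((mul_eq_zero.mp hprod).resolve_right hpos.ne')
    have hcubic : x₁ * (x₁ ^ 2 - α) = 0 := by linear_combination h₁
    rcases mul_eq_zero.mp hcubic with h | h
    · exact Or.inl ⟨h, h⟩
    · have hsq : x₁ ^ 2 = Real.sqrt α ^ 2 := by rw [hs]; exact sub_eq_zero.mp h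
      rcases sq_eq_sq_iff_eq_or_eq_neg.mp hsq with h | h
      · exact Or.inr (Or.inl ⟨h, h⟩)
      · exact Or.inr (Or.inr ⟨h, h⟩)
  · rintro (⟨rfl, rfl⟩ | ⟨rfl, rfl⟩ | ⟨rfl, rfl⟩) <;> simp [hs]
end
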